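/- arXiv:2110.11216 — 4 statements merged into one kernel-verified Lean document; each statement's English description precedes it below -/
import Mathlib

section
/- Catoni's PAC-Bayes bound: for any λ > 0 and any ε ∈ (0,1), with probability at least 1 − ε over the i.i.d. sample S, simultaneously for all ρ ∈ P(Θ): E_{θ∼ρ}[R(θ)] ≤ E_{θ∼ρ}[r(θ)] + λC²/(8n) + ( KL(ρ‖π) + log(1/ε) ) / λ. -/
open MeasureTheory
open scoped ENNReal

/- Kullback-Leibler divergence: `∫ log (dρ/dπ) dρ` when `ρ ≪ π` (and the integral is
well-defined), `+∞` otherwise. -/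
open Classical in
noncomputable def KL {Θ : Type*} [MeasurableSpace Θ] (ρ π : Measure Θ) : ℝ≥0∞ :=
  if ρ ≪ π ∧ Integrable (fun θ => Real.log ((ρ.rnDeriv π) θ).toReal) ρ
  then ENNReal.ofReal (∫ θ, Real.log ((ρ.rnDeriv π) θ).toReal ∂ρ)
  else ⊤

/- The risk `R(θ) = E_{(X,Y)∼P}[ℓ(f_θ(X),Y)]`. -/
noncomputable def risk {X Y Θ : Type*} [MeasurableSpace X] [MeasurableSpace Y]
    (P : Measure (X × Y)) (f : Θ → X → Y) (ℓ : Y → Y → ℝ) (θ : Θ) : ℝ :=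
  ∫ p, ℓ (f θ p.1) p.2 ∂P

/- The empirical risk `r(θ) = (1/n) ∑ᵢ ℓ(f_θ(Xᵢ),Yᵢ)` on the sample `ω`. -/
noncomputable def empRisk {X Y Θ : Type*} (f : Θ → X → Y) (ℓ : Y → Y → ℝ)
    (n : ℕ) (ω : Fin n → X × Y) (θ : Θ) : ℝ :=
  (∑ i, ℓ (f θ (ω i).1) (ω i).2) / n

/- The Gibbs posterior `ρ̂_λ`, with density proportional to `exp (-λ r θ)` w.r.t. `π`. -/
noncomputable def gibbs {X Y Θ : Type*} [MeasurableSpace Θ] (π : Measure Θ)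
    (f : Θ → X → Y) (ℓ : Y → Y → ℝ) (lam : ℝ) (n : ℕ) (ω : Fin n → X × Y) : Measure Θ :=
  π.tilted (fun θ => -lam * empRisk f ℓ n ω θ)

open ProbabilityTheory InformationTheory in
/-- One direction of the Donsker-Varadhan variational formula. -/
theorem integral_le_integral_llr_add_log_integral_exp {Θ : Type*} [MeasurableSpace Θ]
    {ρ π : Measure Θ} [IsProbabilityMeasure ρ] [IsProbabilityMeasure π] {g : Θ → ℝ}
    (hac : ρ ≪ π) (hllr : Integrable (llr ρ π) ρ) (hg : Integrable g ρ)
    (hexp : Integrable (fun θ => Real.exp (g θ)) π) :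
    ∫ θ, g θ ∂ρ ≤ ∫ θ, llr ρ π θ ∂ρ + Real.log (∫ θ, Real.exp (g θ) ∂π) := by
  have := isProbabilityMeasure_tilted hexp
  have hnonneg := integral_llr_add_sub_measure_univ_nonneg
    (hac.trans (absolutelyContinuous_tilted hexp))
    (integrable_llr_tilted_right hac hg hllr hexp)
  rw [integral_llr_tilted_right hac hg hexp hllr] at hnonneg
  simp only [probReal_univ] at hnonneg
  linarith

open ProbabilityTheory in
/-- Exponential moment bound for the deviation of an empirical mean of bounded variables. -/
theorem lintegral_exp_integral_sub_mean_le {Z : Type*} [MeasurableSpace Z]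
    (P : Measure Z) [IsProbabilityMeasure P] {h : Z → ℝ} (hh : Measurable h) {C : ℝ}
    (hb : ∀ z, h z ∈ Set.Icc 0 C) {n : ℕ} (hn : 0 < n) (lam : ℝ) :
    ∫⁻ ω, ENNReal.ofReal (Real.exp (lam * (∫ z, h z ∂P - (∑ i, h (ω i)) / n)))
        ∂(Measure.pi fun _ : Fin n => P)
      ≤ ENNReal.ofReal (Real.exp (lam ^ 2 * C ^ 2 / (8 * n))) := by
  have hn' : (n : ℝ) ≠ 0 := by positivity
  set m := ∫ z, h z ∂P
  have hindep : iIndepFun (fun i (ω : Fin n → Z) => h (ω i) - m)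
      (Measure.pi fun _ : Fin n => P) :=
    iIndepFun_pi (X := fun _ z => h z - m) fun _ => (hh.sub_const m).aemeasurable
  have hsub (i : Fin n) : HasSubgaussianMGF (fun ω : Fin n → Z => h (ω i) - m)
      ((‖C - 0‖₊ / 2) ^ 2) (Measure.pi fun _ : Fin n => P) := by
    have := hasSubgaussianMGF_of_mem_Icc (μ := Measure.pi fun _ : Fin n => P)
      (X := fun ω => h (ω i)) (hh.comp (measurable_pi_apply i)).aemeasurable (ae_of_all _ fun ω => hb (ω i))
    rwa [integral_comp_eval (μ := fun _ : Fin n => P) (f := h) (i := i)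
      hh.aestronglyMeasurable] at this
  have hsum := HasSubgaussianMGF.sum_of_iIndepFun hindep (s := Finset.univ) fun i _ => hsub i
  have heq (ω : Fin n → Z) :
      lam * (m - (∑ i, h (ω i)) / n) = -lam / n * ∑ i, (h (ω i) - m) := by
    rw [Finset.sum_sub_distrib]
    simp only [Finset.sum_const, Finset.card_univ, Fintype.card_fin, nsmul_eq_mul]
    field_simp
    ring
  simp_rw [heq]
  rw [← ofReal_integral_eq_lintegral_ofReal (hsum.integrable_exp_mul _)
    (ae_of_all _ fun _ => (Real.exp_pos _).le)]
  refine ENNReal.ofReal_le_ofReal ((hsum.mgf_le (-lam / n)).trans_eq ?_)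
  congr 1
  simp only [sub_zero, Finset.sum_const, Finset.card_univ, Fintype.card_fin, nsmul_eq_mul]
  push_cast
  rw [div_pow, Real.norm_eq_abs, sq_abs]
  field_simp
  ring

theorem empRisk_mem_Icc {X Y Θ : Type*} {f : Θ → X → Y} {ℓ : Y → Y → ℝ} {C : ℝ}
    (hbound : ∀ y' y : Y, ℓ y' y ∈ Set.Icc 0 C) {n : ℕ} (hn : 0 < n)
    (ω : Fin n → X × Y) (θ : Θ) : empRisk f ℓ n ω θ ∈ Set.Icc 0 C := by
  have hn' : (0 : ℝ) < n := by positivity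
  refine ⟨div_nonneg (Finset.sum_nonneg fun i _ => (hbound _ _).1) hn'.le, ?_⟩
  rw [empRisk, div_le_iff₀ hn']
  refine (Finset.sum_le_sum fun i _ => (hbound _ _).2).trans_eq ?_
  simp [mul_comm]

theorem risk_mem_Icc {X Y Θ : Type*} [MeasurableSpace X] [MeasurableSpace Y]
    (P : Measure (X × Y)) [IsProbabilityMeasure P] {f : Θ → X → Y} {ℓ : Y → Y → ℝ} {C : ℝ}
    (hbound : ∀ y' y : Y, ℓ y' y ∈ Set.Icc 0 C) (θ : Θ) :
    risk P f ℓ θ ∈ Set.Icc 0 C := by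
  refine ⟨integral_nonneg fun p => (hbound _ _).1, ?_⟩
  have := integral_mono_of_nonneg (μ := P) (ae_of_all _ fun p => (hbound (f θ p.1) p.2).1)
    (integrable_const C) (ae_of_all _ fun p => (hbound (f θ p.1) p.2).2)
  simpa [risk] using this

/-- A bound on the exponential moment under the prior yields the PAC-Bayes inequality for every
posterior. -/
theorem lintegral_le_of_integral_exp_le {Θ : Type*} [MeasurableSpace Θ]
    (ρ π : Measure Θ) [IsProbabilityMeasure ρ] [IsProbabilityMeasure π] {R r : Θ → ℝ} {C : ℝ}
    (hR : Measurable R) (hr : Measurable r) (hRC : ∀ θ, R θ ∈ Set.Icc 0 C)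
    (hrC : ∀ θ, r θ ∈ Set.Icc 0 C) {lam a b : ℝ} (hlam : 0 < lam)
    (hexp : ∫ θ, Real.exp (lam * (R θ - r θ)) ∂π ≤ Real.exp (lam * a + b)) :
    ∫⁻ θ, ENNReal.ofReal (R θ) ∂ρ ≤ (∫⁻ θ, ENNReal.ofReal (r θ) ∂ρ) + ENNReal.ofReal a
      + (KL ρ π + ENNReal.ofReal b) / ENNReal.ofReal lam := by
  rw [KL]
  split_ifs with hKL
  swap
  · simp [ENNReal.top_div_of_ne_top ENNReal.ofReal_ne_top]
  obtain ⟨hac, hllr⟩ := hKL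
  have hRi : Integrable R ρ := .of_mem_Icc 0 C hR.aemeasurable (ae_of_all _ hRC)
  have hri : Integrable r ρ := .of_mem_Icc 0 C hr.aemeasurable (ae_of_all _ hrC)
  have hint : Integrable (fun θ => Real.exp (lam * (R θ - r θ))) π := by
    refine .of_mem_Icc 0 (Real.exp (lam * C)) (by fun_prop)
      (ae_of_all _ fun θ => ⟨(Real.exp_pos _).le, Real.exp_le_exp.2 ?_⟩)
    have := (hRC θ).2
    have := (hrC θ).1
    gcongr
    linarith
  have hDV := integral_le_integral_llr_add_log_integral_exp hac hllr
    ((hRi.sub hri).const_mul lam) hint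
  have hlog : Real.log (∫ θ, Real.exp (lam * (R θ - r θ)) ∂π) ≤ lam * a + b :=
    (Real.log_le_iff_le_exp (integral_exp_pos hint)).2 hexp
  simp only [Pi.sub_apply] at hDV
  rw [integral_const_mul, integral_sub hRi hri] at hDV
  rw [← ofReal_integral_eq_lintegral_ofReal hRi (ae_of_all _ fun θ => (hRC θ).1),
    ← ofReal_integral_eq_lintegral_ofReal hri (ae_of_all _ fun θ => (hrC θ).1)]
  calc ENNReal.ofReal (∫ θ, R θ ∂ρ)
      ≤ ENNReal.ofReal (∫ θ, r θ ∂ρ + a + (∫ θ, llr ρ π θ ∂ρ + b) / lam) := by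
        refine ENNReal.ofReal_le_ofReal ?_
        rw [← sub_le_iff_le_add', le_div_iff₀ hlam]
        linarith
    _ ≤ _ := by
        refine ENNReal.ofReal_add_le.trans (add_le_add ENNReal.ofReal_add_le ?_)
        rw [ENNReal.ofReal_div_of_pos hlam]
        gcongr
        exact ENNReal.ofReal_add_le

/-- Catoni's PAC-Bayes bound (Theorem 2.1): for any `λ > 0` and `ε ∈ (0,1)`, with
probability at least `1 - ε` over the i.i.d. sample, simultaneously for all probability
measures `ρ` on `Θ`,
`E_{θ∼ρ}[R(θ)] ≤ E_{θ∼ρ}[r(θ)] + λC²/(8n) + (KL(ρ‖π) + log(1/ε))/λ`. -/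
theorem catoni_pac_bayes_bound
    {X Y Θ : Type*} [MeasurableSpace X] [MeasurableSpace Y] [MeasurableSpace Θ]
    (P : Measure (X × Y)) [IsProbabilityMeasure P]
    (f : Θ → X → Y) (ℓ : Y → Y → ℝ) (C : ℝ) (hC : 0 < C)
    (hmeas : Measurable (fun p : Θ × X × Y => ℓ (f p.1 p.2.1) p.2.2))
    (hbound : ∀ y' y : Y, ℓ y' y ∈ Set.Icc 0 C)
    (π : Measure Θ) [IsProbabilityMeasure π]
    (n : ℕ) (hn : 0 < n) (lam ε : ℝ) (hlam : 0 < lam) (hε : ε ∈ Set.Ioo (0:ℝ) 1) :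
    ENNReal.ofReal (1 - ε) ≤
      (Measure.pi fun _ : Fin n => P)
        {ω | ∀ ρ : Measure Θ, IsProbabilityMeasure ρ →
          ∫⁻ θ, ENNReal.ofReal (risk P f ℓ θ) ∂ρ ≤
            (∫⁻ θ, ENNReal.ofReal (empRisk f ℓ n ω θ) ∂ρ)
              + ENNReal.ofReal (lam * C ^ 2 / (8 * n))
              + (KL ρ π + ENNReal.ofReal (Real.log (1 / ε))) / ENNReal.ofReal lam} := by
  obtain ⟨hε0, hε1⟩ := hε
  have hloss (θ : Θ) : Measurable fun p : X × Y => ℓ (f θ p.1) p.2 :=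
    hmeas.comp measurable_prodMk_left
  have hR : Measurable (risk P f ℓ) :=
    (hmeas.stronglyMeasurable.integral_prod_right').measurable
  have hr : Measurable fun q : (Fin n → X × Y) × Θ => empRisk f ℓ n q.1 q.2 := by
    refine (Finset.measurable_sum _ fun i _ => ?_).div_const _
    exact hmeas.comp (f := fun q : (Fin n → X × Y) × Θ => (q.2, q.1 i)) (by fun_prop)
  have hrω (ω : Fin n → X × Y) : Measurable (empRisk f ℓ n ω) := hr.comp measurable_prodMk_left
  set μ := Measure.pi fun _ : Fin n => P
  set a : ℝ := lam * C ^ 2 / (8 * n)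
  let F : (Fin n → X × Y) → Θ → ℝ≥0∞ := fun ω θ =>
    ENNReal.ofReal (Real.exp (lam * (risk P f ℓ θ - empRisk f ℓ n ω θ)))
  have hF : Measurable (Function.uncurry F) :=
    (((hR.comp measurable_snd).sub hr).const_mul lam).exp.ennreal_ofReal
  have hZ : Measurable fun ω => ∫⁻ θ, F ω θ ∂π := hF.lintegral_prod_right'
  have hmoment : ∫⁻ ω, ∫⁻ θ, F ω θ ∂π ∂μ ≤ ENNReal.ofReal (Real.exp (lam * a)) := by
    rw [lintegral_lintegral_swap hF.aemeasurable]
    refine (lintegral_mono (g := fun _ => ENNReal.ofReal (Real.exp (lam * a))) fun θ => ?_).trans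
      (by simp)
    refine (lintegral_exp_integral_sub_mean_le P (hloss θ) (fun p => hbound _ _) hn lam).trans_eq ?_
    congr 2
    ring
  set t : ℝ := Real.exp (lam * a + Real.log (1 / ε)) with ht
  have ht' : Real.exp (lam * a) = ε * t := by
    rw [ht, Real.exp_add, Real.exp_log (by positivity)]
    field_simp
  have hbad : μ {ω | ENNReal.ofReal t ≤ ∫⁻ θ, F ω θ ∂π} ≤ ENNReal.ofReal ε := by
    refine (meas_ge_le_lintegral_div hZ.aemeasurable
      (ENNReal.ofReal_pos.2 (Real.exp_pos _)).ne' ENNReal.ofReal_ne_top).trans ?_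
    refine ENNReal.div_le_of_le_mul (hmoment.trans_eq ?_)
    rw [ht', ENNReal.ofReal_mul hε0.le]
  calc ENNReal.ofReal (1 - ε) = 1 - ENNReal.ofReal ε := by
        rw [ENNReal.ofReal_sub _ hε0.le, ENNReal.ofReal_one]
    _ ≤ 1 - μ {ω | ENNReal.ofReal t ≤ ∫⁻ θ, F ω θ ∂π} := tsub_le_tsub_left hbad 1
    _ = μ {ω | ENNReal.ofReal t ≤ ∫⁻ θ, F ω θ ∂π}ᶜ :=
        (prob_compl_eq_one_sub (measurableSet_le measurable_const hZ)).symm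
    _ ≤ _ := measure_mono ?_
  intro ω hω ρ _
  refine lintegral_le_of_integral_exp_le ρ π hR (hrω ω) (risk_mem_Icc P hbound)
    (empRisk_mem_Icc hbound hn ω) hlam ?_
  rw [integral_eq_lintegral_of_nonneg_ae (ae_of_all _ fun _ => (Real.exp_pos _).le)
    ((hR.fun_sub (hrω ω)).const_mul lam).exp.aestronglyMeasurable]
  rw [Set.mem_compl_iff, Set.mem_ofPred_eq, not_le] at hω
  exact ENNReal.toReal_le_of_le_ofReal (Real.exp_pos _).le hω.le
end

section
/- PAC-Bayes bound uniform over a grid of temperatures: let Λ ⊂ (0,+∞) be a finite set. For any ε ∈ (0,1), with probability at least 1 − ε over the sample S, simultaneously for all ρ ∈ P(Θ) and all λ ∈ Λ: E_{θ∼ρ}[R(θ)] ≤ E_{θ∼ρ}[r(θ)] + λC²/(8n) + ( KL(ρ‖π) + log(card(Λ)/ε) ) / λ. -/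
open MeasureTheory
open scoped ENNReal

/-- The Donsker-Varadhan inequality. -/
lemma integral_le_integral_llr_add_log {Θ : Type*} [MeasurableSpace Θ] {ρ π : Measure Θ}
    [IsProbabilityMeasure ρ] [IsProbabilityMeasure π] (hac : ρ ≪ π)
    (hllr : Integrable (llr ρ π) ρ) {h : Θ → ℝ} (hρ : Integrable h ρ)
    (hπ : Integrable (fun θ => Real.exp (h θ)) π) :
    ∫ θ, h θ ∂ρ ≤ ∫ θ, llr ρ π θ ∂ρ + Real.log (∫ θ, Real.exp (h θ) ∂π) := by
  have := isProbabilityMeasure_tilted hπ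
  have hnonneg := InformationTheory.integral_llr_add_sub_measure_univ_nonneg
    (hac.trans (absolutelyContinuous_tilted hπ)) (integrable_llr_tilted_right hac hρ hllr hπ)
  rw [integral_llr_tilted_right hac hρ hπ hllr, probReal_univ, probReal_univ] at hnonneg
  linarith

/-- Hoeffding's bound on the exponential moment of the gap between the mean and the empirical
mean of a bounded function. -/
lemma lintegral_exp_mean_sub_empirical_le {Z : Type*} [MeasurableSpace Z] (P : Measure Z)
    [IsProbabilityMeasure P] {g : Z → ℝ} (hg : Measurable g) {C : ℝ}
    (hgC : ∀ z, g z ∈ Set.Icc 0 C) {n : ℕ} (hn : 0 < n) (lam : ℝ) :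
    ∫⁻ ω, ENNReal.ofReal (Real.exp (lam * (∫ z, g z ∂P - (∑ i, g (ω i)) / n)))
        ∂(Measure.pi fun _ : Fin n => P)
      ≤ ENNReal.ofReal (Real.exp (lam ^ 2 * C ^ 2 / (8 * n))) := by
  set m : ℝ := ∫ z, g z ∂P with hm
  set Q := Measure.pi fun _ : Fin n => P
  have hsub (i : Fin n) : ProbabilityTheory.HasSubgaussianMGF
      (fun ω : Fin n → Z => g (ω i) - m) ((‖C - 0‖₊ / 2) ^ 2) Q := by
    have h := ProbabilityTheory.hasSubgaussianMGF_of_mem_Icc (μ := Q) (a := 0) (b := C)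
      (X := fun ω : Fin n → Z => g (ω i)) (hg.comp (measurable_pi_apply i)).aemeasurable
      (ae_of_all _ fun ω => hgC _)
    rwa [integral_comp_eval (μ := fun _ : Fin n => P) (f := g)
      hg.aestronglyMeasurable] at h
  have hind : ProbabilityTheory.iIndepFun (fun (i : Fin n) (ω : Fin n → Z) => g (ω i) - m) Q :=
    ProbabilityTheory.iIndepFun_pi (X := fun _ z => g z - m) fun _ => by fun_prop
  have hsum := ProbabilityTheory.HasSubgaussianMGF.sum_of_iIndepFun hind
    (s := Finset.univ) fun i _ => hsub i
  have hn' : (n : ℝ) ≠ 0 := by positivity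
  have hexp (ω : Fin n → Z) : lam * (m - (∑ i, g (ω i)) / n)
      = -lam / n * ∑ i, (g (ω i) - m) := by
    rw [Finset.sum_sub_distrib, Finset.sum_const, Finset.card_univ, Fintype.card_fin, nsmul_eq_mul]
    field_simp
    ring
  simp_rw [hexp]
  rw [← ofReal_integral_eq_lintegral_ofReal (hsum.integrable_exp_mul _)
    (ae_of_all _ fun ω => (Real.exp_pos _).le)]
  refine ENNReal.ofReal_le_ofReal ((hsum.mgf_le (-lam / n)).trans_eq ?_)
  congr 1
  simp only [sub_zero, Finset.sum_const, Finset.card_univ, Fintype.card_fin, nsmul_eq_mul]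
  push_cast
  rw [Real.norm_eq_abs, div_pow, sq_abs]
  field_simp
  ring

/-- A bound on an exponential moment under the prior turns into a PAC-Bayes inequality for
every posterior and a fixed temperature. -/
lemma lintegral_le_of_lintegral_exp_le {Θ : Type*} [MeasurableSpace Θ] {ρ π : Measure Θ}
    [IsProbabilityMeasure ρ] [IsProbabilityMeasure π] {R r : Θ → ℝ} {C : ℝ}
    (hR : Measurable R) (hr : Measurable r) (hRC : ∀ θ, R θ ∈ Set.Icc 0 C)
    (hrC : ∀ θ, r θ ∈ Set.Icc 0 C) {lam c K : ℝ} (hlam : 0 < lam) (hK : 0 < K)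
    (h : ∫⁻ θ, ENNReal.ofReal (Real.exp (lam * (R θ - r θ) - lam * c)) ∂π
      ≤ ENNReal.ofReal K) :
    ∫⁻ θ, ENNReal.ofReal (R θ) ∂ρ ≤ ∫⁻ θ, ENNReal.ofReal (r θ) ∂ρ + ENNReal.ofReal c
      + (KL ρ π + ENNReal.ofReal (Real.log K)) / ENNReal.ofReal lam := by
  by_cases hKL : ρ ≪ π ∧ Integrable (fun θ => Real.log ((ρ.rnDeriv π) θ).toReal) ρ
  swap
  · simp [KL, hKL, ENNReal.top_div_of_ne_top]
  obtain ⟨hac, hllr⟩ := hKL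
  have hRi : Integrable R ρ := .of_mem_Icc 0 C hR.aemeasurable (ae_of_all _ hRC)
  have hri : Integrable r ρ := .of_mem_Icc 0 C hr.aemeasurable (ae_of_all _ hrC)
  have hexp : Integrable (fun θ => Real.exp (lam * (R θ - r θ) - lam * c)) π := by
    refine ⟨by fun_prop, ?_⟩
    rw [hasFiniteIntegral_iff_ofReal (ae_of_all _ fun θ => (Real.exp_pos _).le)]
    exact h.trans_lt ENNReal.ofReal_lt_top
  have hlog : Real.log (∫ θ, Real.exp (lam * (R θ - r θ) - lam * c) ∂π) ≤ Real.log K := by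
    refine Real.log_le_log (integral_exp_pos hexp) ?_
    rwa [← ENNReal.ofReal_le_ofReal_iff hK.le, ofReal_integral_eq_lintegral_ofReal hexp
      (ae_of_all _ fun θ => (Real.exp_pos _).le)]
  have hgap : Integrable (fun θ => lam * (R θ - r θ)) ρ := (hRi.sub hri).const_mul lam
  have hDV := integral_le_integral_llr_add_log hac hllr
    (hgap.sub (integrable_const (lam * c))) hexp
  simp only [Pi.sub_apply] at hDV
  rw [integral_sub hgap (integrable_const _), integral_const_mul, integral_sub hRi hri, integral_const, probReal_univ, one_smul] at hDV
  have hreal : ∫ θ, R θ ∂ρ ≤ ∫ θ, r θ ∂ρ + c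
      + (∫ θ, llr ρ π θ ∂ρ + Real.log K) / lam := by
    rw [← sub_le_iff_le_add', le_div_iff₀ hlam]
    linarith
  rw [← ofReal_integral_eq_lintegral_ofReal hRi (ae_of_all _ fun θ => (hRC θ).1),
    ← ofReal_integral_eq_lintegral_ofReal hri (ae_of_all _ fun θ => (hrC θ).1)]
  refine (ENNReal.ofReal_le_ofReal hreal).trans (ENNReal.ofReal_add_le.trans ?_)
  refine add_le_add ENNReal.ofReal_add_le ?_
  rw [ENNReal.ofReal_div_of_pos hlam, KL, if_pos ⟨hac, hllr⟩]
  exact ENNReal.div_le_div_right ENNReal.ofReal_add_le _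

/-- The union bound with Markov's inequality over a finite family. -/
lemma ofReal_one_sub_le_measure_forall_lt {Ω ι : Type*} [MeasurableSpace Ω] (Q : Measure Ω)
    [IsProbabilityMeasure Q] (s : Finset ι) {F : ι → Ω → ℝ≥0∞} (hF : ∀ i ∈ s, Measurable (F i))
    (hint : ∀ i ∈ s, ∫⁻ ω, F i ω ∂Q ≤ 1) {ε : ℝ} (hε : 0 < ε) :
    ENNReal.ofReal (1 - ε) ≤ Q {ω | ∀ i ∈ s, F i ω < ENNReal.ofReal (s.card / ε)} := by
  have hmeas : MeasurableSet {ω | ∀ i ∈ s, F i ω < ENNReal.ofReal (s.card / ε)} := by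
    have hinter : {ω | ∀ i ∈ s, F i ω < ENNReal.ofReal (s.card / ε)}
        = ⋂ i ∈ s, {ω | F i ω < ENNReal.ofReal (s.card / ε)} := by
      ext ω
      simp
    rw [hinter]
    exact s.measurableSet_biInter fun i hi => measurableSet_lt (hF i hi) measurable_const
  have hbad : Q {ω | ∀ i ∈ s, F i ω < ENNReal.ofReal (s.card / ε)}ᶜ ≤ ENNReal.ofReal ε := by
    have hunion : {ω | ∀ i ∈ s, F i ω < ENNReal.ofReal (s.card / ε)}ᶜ
        = ⋃ i ∈ s, {ω | ENNReal.ofReal (s.card / ε) ≤ F i ω} := by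
      ext ω
      simp
    rw [hunion]
    rcases s.eq_empty_or_nonempty with rfl | hs
    · simp
    have hcard : (0 : ℝ) < s.card := by exact_mod_cast hs.card_pos
    have hpos : 0 < (s.card : ℝ) / ε := by positivity
    calc Q (⋃ i ∈ s, {ω | ENNReal.ofReal (s.card / ε) ≤ F i ω})
        ≤ ∑ i ∈ s, Q {ω | ENNReal.ofReal (s.card / ε) ≤ F i ω} :=
          measure_biUnion_finset_le _ _
      _ ≤ ∑ _i ∈ s, ENNReal.ofReal (ε / s.card) := by
          refine Finset.sum_le_sum fun i hi => ?_
          refine (meas_ge_le_lintegral_div (hF i hi).aemeasurable (by simpa using hpos)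
            ENNReal.ofReal_ne_top).trans ?_
          refine (ENNReal.div_le_div_right (hint i hi) _).trans_eq ?_
          rw [one_div, ← ENNReal.ofReal_inv_of_pos hpos, inv_div]
      _ = ENNReal.ofReal ε := by
          rw [Finset.sum_const, nsmul_eq_mul, ← ENNReal.ofReal_natCast,
            ← ENNReal.ofReal_mul hcard.le, mul_div_cancel₀ _ hcard.ne']
  rw [← compl_compl {ω | ∀ i ∈ s, F i ω < ENNReal.ofReal (s.card / ε)},
    prob_compl_eq_one_sub hmeas.compl, ENNReal.ofReal_sub _ hε.le, ENNReal.ofReal_one]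
  exact tsub_le_tsub_left hbad 1

/-- PAC-Bayes bound uniform over a finite grid `Λ ⊂ (0,∞)` of temperatures: with
probability at least `1 - ε`, simultaneously for all `ρ ∈ P(Θ)` and all `λ ∈ Λ`,
`E_{θ∼ρ}[R(θ)] ≤ E_{θ∼ρ}[r(θ)] + λC²/(8n) + (KL(ρ‖π) + log(card(Λ)/ε))/λ`. -/
theorem pac_bayes_bound_grid
    {X Y Θ : Type*} [MeasurableSpace X] [MeasurableSpace Y] [MeasurableSpace Θ]
    (P : Measure (X × Y)) [IsProbabilityMeasure P]
    (f : Θ → X → Y) (ℓ : Y → Y → ℝ) (C : ℝ) (hC : 0 < C)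
    (hmeas : Measurable (fun p : Θ × X × Y => ℓ (f p.1 p.2.1) p.2.2))
    (hbound : ∀ y' y : Y, ℓ y' y ∈ Set.Icc 0 C)
    (π : Measure Θ) [IsProbabilityMeasure π]
    (n : ℕ) (hn : 0 < n) (Λ : Finset ℝ) (hΛ : ∀ lam ∈ Λ, (0:ℝ) < lam)
    (ε : ℝ) (hε : ε ∈ Set.Ioo (0:ℝ) 1) :
    ENNReal.ofReal (1 - ε) ≤
      (Measure.pi fun _ : Fin n => P)
        {ω | ∀ ρ : Measure Θ, IsProbabilityMeasure ρ → ∀ lam ∈ Λ,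
          ∫⁻ θ, ENNReal.ofReal (risk P f ℓ θ) ∂ρ ≤
            (∫⁻ θ, ENNReal.ofReal (empRisk f ℓ n ω θ) ∂ρ)
              + ENNReal.ofReal (lam * C ^ 2 / (8 * n))
              + (KL ρ π + ENNReal.ofReal (Real.log (Λ.card / ε))) / ENNReal.ofReal lam} := by
  have hloss (θ : Θ) : Measurable (fun p : X × Y => ℓ (f θ p.1) p.2) :=
    hmeas.comp measurable_prodMk_left
  have hn' : (0 : ℝ) < n := by exact_mod_cast hn
  have hR : Measurable (risk P f ℓ) :=
    (hmeas.stronglyMeasurable.integral_prod_right (ν := P)).measurable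
  have hr : Measurable (fun q : (Fin n → X × Y) × Θ => empRisk f ℓ n q.1 q.2) := by
    refine (Finset.measurable_sum _ fun i _ => ?_).div_const _
    exact hmeas.comp (f := fun q : (Fin n → X × Y) × Θ => (q.2, q.1 i)) (by fun_prop)
  have hRC (θ : Θ) : risk P f ℓ θ ∈ Set.Icc 0 C := by
    refine ⟨integral_nonneg fun p => (hbound _ _).1, ?_⟩
    simpa [risk] using integral_mono (μ := P) (.of_mem_Icc 0 C (hloss θ).aemeasurable
      (ae_of_all _ fun p => hbound _ _)) (integrable_const C) fun p => (hbound _ _).2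
  have hrC (ω : Fin n → X × Y) (θ : Θ) : empRisk f ℓ n ω θ ∈ Set.Icc 0 C := by
    refine ⟨div_nonneg (Finset.sum_nonneg fun i _ => (hbound _ _).1) hn'.le, ?_⟩
    rw [empRisk, div_le_iff₀ hn']
    refine (Finset.sum_le_sum fun i _ => (hbound _ _).2).trans_eq ?_
    simp [mul_comm]
  have hF (lam : ℝ) : Measurable (fun q : (Fin n → X × Y) × Θ => ENNReal.ofReal (Real.exp
      (lam * (risk P f ℓ q.2 - empRisk f ℓ n q.1 q.2) - lam * (lam * C ^ 2 / (8 * n))))) := by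
    fun_prop
  refine (ofReal_one_sub_le_measure_forall_lt _ Λ (F := fun lam ω => ∫⁻ θ, ENNReal.ofReal
    (Real.exp (lam * (risk P f ℓ θ - empRisk f ℓ n ω θ) - lam * (lam * C ^ 2 / (8 * n)))) ∂π)
    (fun lam _ => (hF lam).lintegral_prod_right') (fun lam _ => ?_) hε.1).trans
    (measure_mono fun ω hω ρ _ lam hlam => ?_)
  · rw [lintegral_lintegral_swap (hF lam).aemeasurable]
    refine (lintegral_mono (g := fun _ => 1) fun θ => ?_).trans_eq (by simp)
    have h := lintegral_exp_mean_sub_empirical_le P (hloss θ) (fun p => hbound _ _) hn lam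
    simp_rw [Real.exp_sub, div_eq_mul_inv (Real.exp _), ENNReal.ofReal_mul (Real.exp_pos _).le]
    rw [lintegral_mul_const' _ _ ENNReal.ofReal_ne_top]
    refine (mul_le_mul_left h _).trans_eq ?_
    rw [← ENNReal.ofReal_mul (Real.exp_pos _).le,
      show lam * (lam * C ^ 2 / (8 * n)) = lam ^ 2 * C ^ 2 / (8 * n) by ring,
      mul_inv_cancel₀ (Real.exp_pos _).ne', ENNReal.ofReal_one]
  · have hcard : (0 : ℝ) < Λ.card := by exact_mod_cast Finset.card_pos.2 ⟨lam, hlam⟩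
    exact lintegral_le_of_lintegral_exp_le hR (hr.comp measurable_prodMk_left) hRC (hrC ω)
      (hΛ lam hlam) (div_pos hcard hε.1) (hω lam hlam).le
end

section
/- PAC-Bayes bound for a single draw from the posterior: for any λ > 0, any ε ∈ (0,1), and any data-dependent probability measure ρ̃ on Θ (a regular conditional probability given the sample, absolutely continuous with respect to π almost surely), with probability at least 1 − ε over the joint draw of the sample S and of θ̃ ∼ ρ̃: R(θ̃) ≤ r(θ̃) + λC²/(8n) + ( log( (dρ̃/dπ)(θ̃) ) + log(1/ε) ) / λ. -/
open MeasureTheory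
open scoped ENNReal

open ProbabilityTheory

lemma MeasureTheory.Measure.AbsolutelyContinuous.measure_le_lintegral_of_rnDeriv_le
    {Θ : Type*} [MeasurableSpace Θ] {ρ π : Measure Θ} [SigmaFinite ρ] [SigmaFinite π]
    (hac : ρ ≪ π) {s : Set Θ} (hs : MeasurableSet s) {g : Θ → ℝ≥0∞}
    (h : ∀ θ ∈ s, ρ.rnDeriv π θ ≠ ∞ → ρ.rnDeriv π θ ≤ g θ) :
    ρ s ≤ ∫⁻ θ, g θ ∂π := by
  rw [← Measure.setLIntegral_rnDeriv' hac hs]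
  refine (setLIntegral_mono_ae' hs ?_).trans (setLIntegral_le_lintegral s g)
  filter_upwards [Measure.rnDeriv_ne_top ρ π] with θ hθ hmem using h θ hmem hθ

/-- A lower bound on the outer measure of a possibly non-measurable set under `μ ⊗ₘ κ`, from
upper bounds on the measurable subsets of the fibres of its complement. -/
lemma MeasureTheory.Measure.one_sub_le_compProd_of_fiber_compl_le
    {Ω Θ : Type*} [MeasurableSpace Ω] [MeasurableSpace Θ] {μ : Measure Ω} [IsProbabilityMeasure μ]
    {κ : Kernel Ω Θ} [IsMarkovKernel κ] {U : Set (Ω × Θ)} {h : Ω → ℝ≥0∞} {δ : ℝ≥0∞}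
    (hU : ∀ ω s, MeasurableSet s → (∀ θ ∈ s, (ω, θ) ∉ U) → κ ω s ≤ h ω)
    (hδ : ∫⁻ ω, h ω ∂μ ≤ δ) :
    1 - δ ≤ (μ.compProd κ) U := by
  set T := toMeasurable (μ.compProd κ) U
  have hT : MeasurableSet T := measurableSet_toMeasurable _ _
  have hcompl : (μ.compProd κ) Tᶜ ≤ δ := by
    rw [Measure.compProd_apply hT.compl]
    refine (lintegral_mono fun ω => hU ω _ (hT.compl.preimage measurable_prodMk_left) ?_).trans hδ
    exact fun θ hθ hmem => hθ (subset_toMeasurable _ _ hmem)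
  rw [← measure_toMeasurable U, tsub_le_iff_right, ← prob_add_prob_compl (μ := μ.compProd κ) hT]
  gcongr

section Risk

variable {X Y Θ : Type*} [MeasurableSpace X] [MeasurableSpace Y] [MeasurableSpace Θ]
  (P : Measure (X × Y)) [IsProbabilityMeasure P] {f : Θ → X → Y} {ℓ : Y → Y → ℝ}

lemma measurable_risk (hmeas : Measurable (fun p : Θ × X × Y => ℓ (f p.1 p.2.1) p.2.2)) :
    Measurable (risk P f ℓ) :=
  (StronglyMeasurable.integral_prod_right' (ν := P) hmeas.stronglyMeasurable).measurable

lemma measurable_empRisk (hmeas : Measurable (fun p : Θ × X × Y => ℓ (f p.1 p.2.1) p.2.2))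
    (n : ℕ) : Measurable (fun q : (Fin n → X × Y) × Θ => empRisk f ℓ n q.1 q.2) := by
  refine Measurable.div_const (Finset.measurable_sum _ fun i _ => ?_) _
  exact hmeas.comp (g := fun p : Θ × X × Y => ℓ (f p.1 p.2.1) p.2.2)
    (f := fun q : (Fin n → X × Y) × Θ => (q.2, q.1 i)) (by fun_prop)

lemma hasSubgaussianMGF_risk_sub_empRisk {C : ℝ}
    (hmeas : Measurable (fun p : Θ × X × Y => ℓ (f p.1 p.2.1) p.2.2))
    (hbound : ∀ y' y : Y, ℓ y' y ∈ Set.Icc 0 C) {n : ℕ} (hn : 0 < n) (θ : Θ) :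
    HasSubgaussianMGF (fun ω => n * (risk P f ℓ θ - empRisk f ℓ n ω θ))
      (n * (‖C‖₊ / 2) ^ 2) (Measure.pi fun _ : Fin n => P) := by
  have hm : Measurable (fun p : X × Y => ℓ (f θ p.1) p.2) := hmeas.comp measurable_prodMk_left
  have hsub : HasSubgaussianMGF (fun p : X × Y => risk P f ℓ θ - ℓ (f θ p.1) p.2)
      ((‖C‖₊ / 2) ^ 2) P := by
    have := (hasSubgaussianMGF_of_mem_Icc (μ := P) hm.aemeasurable
      (ae_of_all _ fun p => hbound (f θ p.1) p.2)).neg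
    rw [sub_zero] at this
    refine this.congr (ae_of_all _ fun p => ?_)
    simp [risk]
  have hindep := iIndepFun_pi (μ := fun _ : Fin n => P)
    (X := fun _ (p : X × Y) => risk P f ℓ θ - ℓ (f θ p.1) p.2)
    fun _ => (hm.const_sub _).aemeasurable
  have hsum := HasSubgaussianMGF.sum_of_iIndepFun hindep (c := fun _ => (‖C‖₊ / 2) ^ 2)
    (s := Finset.univ) fun i _ => by
      refine HasSubgaussianMGF.of_map (Y := fun ω : Fin n → X × Y => ω i)
        (X := fun p : X × Y => risk P f ℓ θ - ℓ (f θ p.1) p.2)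
        (measurable_pi_apply i).aemeasurable ?_
      rwa [(measurePreserving_eval (fun _ : Fin n => P) i).map_eq]
  have hn' : (n : ℝ) ≠ 0 := by positivity
  simp only [Finset.sum_const, Finset.card_univ, Fintype.card_fin, nsmul_eq_mul] at hsum
  refine hsum.congr (ae_of_all _ fun ω => ?_)
  simp only [empRisk, Finset.sum_sub_distrib, Finset.sum_const, Finset.card_univ,
    Fintype.card_fin, nsmul_eq_mul]
  field_simp

lemma lintegral_exp_risk_sub_empRisk_le_one {C : ℝ}
    (hmeas : Measurable (fun p : Θ × X × Y => ℓ (f p.1 p.2.1) p.2.2))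
    (hbound : ∀ y' y : Y, ℓ y' y ∈ Set.Icc 0 C) {n : ℕ} (hn : 0 < n) (lam : ℝ) (θ : Θ) :
    ∫⁻ ω, ENNReal.ofReal (Real.exp (lam * (risk P f ℓ θ - empRisk f ℓ n ω θ)
      - lam ^ 2 * C ^ 2 / (8 * n))) ∂(Measure.pi fun _ : Fin n => P) ≤ 1 := by
  have hn' : (n : ℝ) ≠ 0 := by positivity
  have hsub := hasSubgaussianMGF_risk_sub_empRisk P hmeas hbound hn θ
  have hint := hsub.integrable_exp_mul (lam / n)
  have hle := hsub.mgf_le (lam / n)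
  have hexp : ∀ ω, Real.exp (lam * (risk P f ℓ θ - empRisk f ℓ n ω θ)
      - lam ^ 2 * C ^ 2 / (8 * n)) =
      Real.exp (lam / n * (n * (risk P f ℓ θ - empRisk f ℓ n ω θ)))
        * Real.exp (-(lam ^ 2 * C ^ 2 / (8 * n))) := fun ω => by
    rw [← Real.exp_add]
    congr 1
    field_simp
    ring
  simp_rw [hexp]
  rw [← ofReal_integral_eq_lintegral_ofReal (hint.mul_const _)
    (ae_of_all _ fun ω => by positivity), integral_mul_const]
  refine ENNReal.ofReal_le_one.2 ?_
  calc _ ≤ Real.exp (((n * (‖C‖₊ / 2) ^ 2 : NNReal) : ℝ) * (lam / n) ^ 2 / 2)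
        * Real.exp (-(lam ^ 2 * C ^ 2 / (8 * n))) := by gcongr; exact hle
    _ = 1 := by
      rw [← Real.exp_add, Real.exp_eq_one_iff]
      push_cast
      rw [Real.norm_eq_abs, div_pow, sq_abs]
      field_simp
      ring

end Risk

/-- PAC-Bayes bound on a single draw from a data-dependent probability measure `ρ̃`
(a Markov kernel from samples to `Θ`, absolutely continuous w.r.t. `π`): with probability
at least `1 - ε` over the joint draw of the sample `S` and of `θ̃ ∼ ρ̃(S)`,
`R(θ̃) ≤ r(θ̃) + λC²/(8n) + (log((dρ̃/dπ)(θ̃)) + log(1/ε))/λ`. -/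
theorem pac_bayes_bound_single_draw
    {X Y Θ : Type*} [MeasurableSpace X] [MeasurableSpace Y] [MeasurableSpace Θ]
    (P : Measure (X × Y)) [IsProbabilityMeasure P]
    (f : Θ → X → Y) (ℓ : Y → Y → ℝ) (C : ℝ) (hC : 0 < C)
    (hmeas : Measurable (fun p : Θ × X × Y => ℓ (f p.1 p.2.1) p.2.2))
    (hbound : ∀ y' y : Y, ℓ y' y ∈ Set.Icc 0 C)
    (π : Measure Θ) [IsProbabilityMeasure π]
    (n : ℕ) (hn : 0 < n) (lam ε : ℝ) (hlam : 0 < lam) (hε : ε ∈ Set.Ioo (0:ℝ) 1)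
    (ρ' : Kernel (Fin n → X × Y) Θ) [IsMarkovKernel ρ']
    (hac : ∀ ω, ρ' ω ≪ π) :
    ENNReal.ofReal (1 - ε) ≤
      ((Measure.pi fun _ : Fin n => P).compProd ρ')
        {q | risk P f ℓ q.2 ≤
          empRisk f ℓ n q.1 q.2 + lam * C ^ 2 / (8 * n)
            + (Real.log (((ρ' q.1).rnDeriv π q.2).toReal) + Real.log (1 / ε)) / lam} := by
  have hε0 : 0 < ε := hε.1
  let g : (Fin n → X × Y) × Θ → ℝ≥0∞ := fun q => ENNReal.ofReal (Real.exp
    (lam * (risk P f ℓ q.2 - empRisk f ℓ n q.1 q.2) - lam ^ 2 * C ^ 2 / (8 * n)))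
  have hg : Measurable g := by
    have hrisk := (measurable_risk P hmeas).comp
      (measurable_snd : Measurable (Prod.snd : (Fin n → X × Y) × Θ → Θ))
    exact ((((hrisk.sub (measurable_empRisk hmeas n)).const_mul lam).sub_const _).exp).ennreal_ofReal
  rw [ENNReal.ofReal_sub _ hε0.le, ENNReal.ofReal_one]
  refine Measure.one_sub_le_compProd_of_fiber_compl_le
    (h := fun ω => ∫⁻ θ, ENNReal.ofReal ε * g (ω, θ) ∂π) (fun ω s hs hU => ?_) ?_
  · refine (hac ω).measure_le_lintegral_of_rnDeriv_le hs fun θ hθ htop => ?_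
    rcases eq_or_ne ((ρ' ω).rnDeriv π θ) 0 with h0 | h0
    · simp [h0]
    have hbad := hU θ hθ
    simp only [Set.mem_ofPred_eq, not_le] at hbad
    have hpos : 0 < ((ρ' ω).rnDeriv π θ).toReal := ENNReal.toReal_pos h0 htop
    rw [← ENNReal.ofReal_mul hε0.le]
    refine ENNReal.le_ofReal_iff_toReal_le htop (by positivity) |>.2 ?_
    rw [← Real.log_le_log_iff hpos (by positivity), Real.log_mul hε0.ne' (Real.exp_ne_zero _),
      Real.log_exp]
    have hmul := mul_lt_mul_of_pos_left hbad hlam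
    rw [mul_add, mul_add, mul_div_cancel₀ _ hlam.ne', one_div, Real.log_inv] at hmul
    have hsq : lam * (lam * C ^ 2 / (8 * n)) = lam ^ 2 * C ^ 2 / (8 * n) := by ring
    linarith
  · rw [lintegral_lintegral_swap (hg.const_mul _).aemeasurable]
    calc ∫⁻ θ, ∫⁻ ω, ENNReal.ofReal ε * g (ω, θ) ∂(Measure.pi fun _ => P) ∂π
        ≤ ∫⁻ _, ENNReal.ofReal ε ∂π := by
          refine lintegral_mono fun θ => ?_
          have hgθ : Measurable fun ω => g (ω, θ) := hg.comp measurable_prodMk_right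
          rw [lintegral_const_mul _ hgθ]
          exact mul_le_of_le_one_right'
            (lintegral_exp_risk_sub_empRisk_le_one P hmeas hbound hn lam θ)
      _ = ENNReal.ofReal ε := by simp
end

section
/- Fast-rate oracle PAC-Bayes bound under Bernstein's condition: assume there exists θ* ∈ Θ with R(θ*) = min over θ ∈ Θ of R(θ), and that the Bernstein assumption holds with constant K > 0, i.e. for every θ ∈ Θ, E_{(X,Y)∼P}[ (ℓ(f_θ(X),Y) − ℓ(f_{θ*}(X),Y))² ] ≤ K ( R(θ) − R(θ*) ). Take λ = n / max(2K, C). Then the Gibbs posterior ρ̂_λ with density proportional to exp(−λ r(θ)) with respect to π satisfies E_S E_{θ∼ρ̂_λ}[R(θ)] − R(θ*) ≤ 2 · inf over ρ ∈ P(Θ) of ( E_{θ∼ρ}[R(θ)] − R(θ*) + max(2K, C) · KL(ρ‖π) / n ). -/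
open MeasureTheory
open scoped ENNReal

open Real in
/-- A Bernstein-type bound on the Laplace transform of a bounded random variable whose second
moment is controlled by its mean. -/
lemma integral_exp_neg_div_le_of_bernstein {Z : Type*} [MeasurableSpace Z]
    (P : Measure Z) [IsProbabilityMeasure P] {d : Z → ℝ} (hd : Measurable d)
    {M K : ℝ} (hM : 0 < M) (hKM : 2 * K ≤ M) (hdM : ∀ z, |d z| ≤ M)
    (hd0 : 0 ≤ ∫ z, d z ∂P) (hB : ∫ z, d z ^ 2 ∂P ≤ K * ∫ z, d z ∂P) :
    ∫ z, exp (-(d z) / M) ∂P ≤ exp (-(∫ z, d z ∂P) / (2 * M)) := by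
  have hid : Integrable d P := Integrable.of_bound hd.aestronglyMeasurable M (.of_forall hdM)
  have hid2 : Integrable (fun z => d z ^ 2) P := by
    refine Integrable.of_bound (hd.pow_const 2).aestronglyMeasurable (M ^ 2) (.of_forall fun z => ?_)
    rw [norm_pow]
    exact pow_le_pow_left₀ (norm_nonneg _) (hdM z) 2
  have habs : ∀ z, |-(d z) / M| ≤ 1 := fun z => by
    rw [abs_div, abs_neg, abs_of_pos hM, div_le_one hM]
    exact hdM z
  have hie : Integrable (fun z => exp (-(d z) / M)) P := by
    refine Integrable.of_bound (by fun_prop) (exp 1) (.of_forall fun z => ?_)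
    rw [norm_of_nonneg (exp_nonneg _)]
    exact exp_le_exp.2 (le_of_abs_le (habs z))
  have hpt : ∀ z, exp (-(d z) / M) ≤ 1 - d z / M + d z ^ 2 / M ^ 2 := fun z => by
    have h := le_of_abs_le (abs_exp_sub_one_sub_id_le (habs z))
    have e : (-(d z) / M) ^ 2 = d z ^ 2 / M ^ 2 := by ring
    have e' : -(d z) / M = -(d z / M) := by ring
    rw [e] at h
    linarith
  have h1 : ∫ z, exp (-(d z) / M) ∂P ≤ ∫ z, (1 - d z / M + d z ^ 2 / M ^ 2) ∂P :=
    integral_mono hie (((integrable_const _).sub (hid.div_const _)).add (hid2.div_const _)) hpt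
  have hi1 : Integrable (fun z => 1 - d z / M) P := (integrable_const _).sub (hid.div_const _)
  rw [integral_add hi1 (hid2.div_const _),
    integral_sub (integrable_const _) (hid.div_const _), integral_div, integral_div] at h1
  simp only [integral_const, probReal_univ, one_smul] at h1
  have h2 : (∫ z, d z ^ 2 ∂P) / M ^ 2 ≤ (∫ z, d z ∂P) / (2 * M) := by
    rw [div_le_div_iff₀ (by positivity) (by positivity)]
    calc (∫ z, d z ^ 2 ∂P) * (2 * M) ≤ (K * ∫ z, d z ∂P) * (2 * M) := by gcongr
      _ = (2 * K) * ((∫ z, d z ∂P) * M) := by ring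
      _ ≤ M * ((∫ z, d z ∂P) * M) := by gcongr
      _ = (∫ z, d z ∂P) * M ^ 2 := by ring
  have h3 : (∫ z, d z ∂P) / M = 2 * ((∫ z, d z ∂P) / (2 * M)) := by field_simp
  have h4 := add_one_le_exp (-(∫ z, d z ∂P) / (2 * M))
  rw [neg_div] at h4 ⊢
  linarith

open Real in
/-- The averaged exponential moment of the deviations under the prior is at most one. -/
lemma integrable_and_integral_exp_bernstein_le_one {Z Θ : Type*} [MeasurableSpace Z]
    [MeasurableSpace Θ] (P : Measure Z) [IsProbabilityMeasure P] (ν : Measure Θ)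
    [IsProbabilityMeasure ν] {d : Θ → Z → ℝ} (hd : Measurable (Function.uncurry d))
    {M K : ℝ} (hM : 0 < M) (hKM : 2 * K ≤ M) (hdM : ∀ θ z, |d θ z| ≤ M)
    (hd0 : ∀ θ, 0 ≤ ∫ z, d θ z ∂P)
    (hB : ∀ θ, ∫ z, d θ z ^ 2 ∂P ≤ K * ∫ z, d θ z ∂P) (n : ℕ) :
    Integrable (fun ω : Fin n → Z =>
        ∫ θ, exp (n * (∫ z, d θ z ∂P) / (2 * M) - (∑ i, d θ (ω i)) / M) ∂ν)
        (Measure.pi fun _ => P) ∧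
      ∫ ω : Fin n → Z, ∫ θ, exp (n * (∫ z, d θ z ∂P) / (2 * M) - (∑ i, d θ (ω i)) / M) ∂ν
        ∂(Measure.pi fun _ => P) ≤ 1 := by
  have hmD : Measurable fun θ => ∫ z, d θ z ∂P :=
    hd.stronglyMeasurable.integral_prod_right.measurable
  have hDM : ∀ θ, ∫ z, d θ z ∂P ≤ M := fun θ => by
    have := norm_integral_le_of_norm_le_const (μ := P) (f := d θ) (.of_forall (hdM θ))
    simpa using (le_abs_self _).trans this
  have hmeas : Measurable (Function.uncurry fun (ω : Fin n → Z) (θ : Θ) =>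
      exp (n * (∫ z, d θ z ∂P) / (2 * M) - (∑ i, d θ (ω i)) / M)) := by
    have h1 : ∀ i : Fin n, Measurable fun p : (Fin n → Z) × Θ => d p.2 (p.1 i) := fun i =>
      hd.comp (measurable_snd.prodMk ((measurable_pi_apply i).comp measurable_fst))
    have h2 : Measurable fun p : (Fin n → Z) × Θ => ∫ z, d p.2 z ∂P := hmD.comp measurable_snd
    simp only [Function.uncurry_def]
    fun_prop
  have hint : Integrable (Function.uncurry fun (ω : Fin n → Z) (θ : Θ) =>
      exp (n * (∫ z, d θ z ∂P) / (2 * M) - (∑ i, d θ (ω i)) / M))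
      ((Measure.pi fun _ => P).prod ν) := by
    refine Integrable.of_bound hmeas.aestronglyMeasurable (exp (n * M / (2 * M) - (-(n * M)) / M))
      (.of_forall fun p => ?_)
    simp only [Function.uncurry_def]
    rw [norm_of_nonneg (exp_nonneg _)]
    have hs : -(n * M) ≤ ∑ i : Fin n, d p.2 (p.1 i) := by
      have := Finset.sum_le_sum fun (i : Fin n) (_ : i ∈ Finset.univ) =>
        neg_le_of_abs_le (hdM p.2 (p.1 i))
      simpa using this
    have := hDM p.2
    gcongr
  refine ⟨hint.integral_prod_left, ?_⟩
  rw [integral_integral_swap hint]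
  have hle : ∀ θ, ∫ ω : Fin n → Z, exp (n * (∫ z, d θ z ∂P) / (2 * M) - (∑ i, d θ (ω i)) / M)
      ∂(Measure.pi fun _ => P) ≤ 1 := fun θ => by
    have e : ∀ ω : Fin n → Z, exp (n * (∫ z, d θ z ∂P) / (2 * M) - (∑ i, d θ (ω i)) / M) =
        exp (n * (∫ z, d θ z ∂P) / (2 * M)) * ∏ i, exp (-(d θ (ω i)) / M) := fun ω => by
      rw [← exp_sum, ← exp_add, ← Finset.sum_div, Finset.sum_neg_distrib]
      ring_nf
    simp_rw [e]
    rw [integral_const_mul, integral_fintype_prod_eq_pow (fun z => exp (-(d θ z) / M)),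
      Fintype.card_fin]
    have hdθ : Measurable (d θ) := hd.comp measurable_prodMk_left
    have hb := integral_exp_neg_div_le_of_bernstein P hdθ hM hKM (hdM θ) (hd0 θ) (hB θ)
    calc _ ≤ exp (n * (∫ z, d θ z ∂P) / (2 * M)) *
          exp (-(∫ z, d θ z ∂P) / (2 * M)) ^ n := by
          gcongr
      _ = 1 := by
          rw [← exp_nat_mul, ← exp_add, exp_eq_one_iff]
          ring
  calc _ ≤ ∫ _, (1 : ℝ) ∂ν := integral_mono hint.integral_prod_right (integrable_const _) hle
    _ = 1 := by simp

open Real in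
/-- Donsker-Varadhan inequality for a bounded function. -/
lemma integral_sub_integral_llr_le_log_integral_exp {Θ : Type*} [MeasurableSpace Θ]
    (ρ ν : Measure Θ) [IsProbabilityMeasure ρ] [IsProbabilityMeasure ν] (hac : ρ ≪ ν)
    (hllr : Integrable (llr ρ ν) ρ) {g : Θ → ℝ} (hgρ : Integrable g ρ)
    (hgν : Integrable (fun θ => exp (g θ)) ν) :
    ∫ θ, g θ ∂ρ - ∫ θ, llr ρ ν θ ∂ρ ≤ log (∫ θ, exp (g θ) ∂ν) := by
  have := isProbabilityMeasure_tilted hgν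
  have h := InformationTheory.integral_llr_add_sub_measure_univ_nonneg
    (hac.trans (absolutelyContinuous_tilted hgν)) (integrable_llr_tilted_right hac hgρ hllr hgν)
  rw [integral_llr_tilted_right hac hgρ hgν hllr] at h
  simp only [probReal_univ] at h
  linarith

open Real in
/-- Comparison of the expectation under a tilted measure with an exponential moment. -/
lemma integral_tilted_le_integral_exp_sub {Θ : Type*} [MeasurableSpace Θ]
    (ν : Measure Θ) [IsProbabilityMeasure ν] {g h : Θ → ℝ}
    (hg : Integrable (fun θ => exp (g θ)) ν) (hh : Integrable h (ν.tilted g))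
    (hgh : Integrable (fun θ => exp (h θ + g θ)) ν) :
    ∫ θ, h θ ∂(ν.tilted g) ≤ ∫ θ, exp (h θ + g θ) ∂ν - 1 - log (∫ θ, exp (g θ) ∂ν) := by
  have := isProbabilityMeasure_tilted hg
  have hZ : 0 < ∫ θ, exp (g θ) ∂ν := integral_exp_pos hg
  set Z := ∫ θ, exp (g θ) ∂ν with hZdef
  have hi : Integrable (fun θ => Z * exp (h θ)) (ν.tilted g) := by
    refine Integrable.const_mul ?_ _
    rw [integrable_tilted_iff hg]
    simpa only [smul_eq_mul, ← exp_add, add_comm] using hgh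
  have hi1 : Integrable (fun θ => Z * exp (h θ) - 1) (ν.tilted g) := hi.sub (integrable_const _)
  have key : ∫ θ, h θ ∂(ν.tilted g) ≤ ∫ θ, (Z * exp (h θ) - 1 - log Z) ∂(ν.tilted g) := by
    refine integral_mono hh (hi1.sub (integrable_const _)) fun θ => ?_
    have h1 := add_one_le_exp (h θ + log Z)
    rw [exp_add, exp_log hZ] at h1
    simp only
    linarith
  rw [integral_sub hi1 (integrable_const _),
    integral_sub hi (integrable_const _), integral_const_mul, integral_exp_tilted, ← hZdef,
    mul_div_cancel₀ _ hZ.ne'] at key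
  simpa [add_comm] using key

/-- Fast-rate oracle PAC-Bayes bound under Bernstein's condition: if `θ*` minimizes `R`,
the Bernstein assumption holds with constant `K > 0`, and `λ = n / max(2K, C)`, then
`E_S E_{θ∼ρ̂_λ}[R(θ)] - R(θ*) ≤ 2 inf_ρ ( E_{θ∼ρ}[R(θ)] - R(θ*) + max(2K,C) KL(ρ‖π)/n )`. -/
theorem fast_rate_oracle_pac_bayes_bound
    {X Y Θ : Type*} [MeasurableSpace X] [MeasurableSpace Y] [MeasurableSpace Θ]
    (P : Measure (X × Y)) [IsProbabilityMeasure P]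
    (f : Θ → X → Y) (ℓ : Y → Y → ℝ) (C : ℝ) (hC : 0 < C)
    (hmeas : Measurable (fun p : Θ × X × Y => ℓ (f p.1 p.2.1) p.2.2))
    (hbound : ∀ y' y : Y, ℓ y' y ∈ Set.Icc 0 C)
    (π : Measure Θ) [IsProbabilityMeasure π]
    (n : ℕ) (hn : 0 < n)
    (θstar : Θ) (hstar : ∀ θ, risk P f ℓ θstar ≤ risk P f ℓ θ)
    (K : ℝ) (hK : 0 < K)
    (hBernstein : ∀ θ : Θ,
      ∫ p, (ℓ (f θ p.1) p.2 - ℓ (f θstar p.1) p.2) ^ 2 ∂P ≤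
        K * (risk P f ℓ θ - risk P f ℓ θstar)) :
    (∫⁻ ω, ∫⁻ θ, ENNReal.ofReal (risk P f ℓ θ)
          ∂(gibbs π f ℓ ((n : ℝ) / max (2 * K) C) n ω)
        ∂(Measure.pi fun _ : Fin n => P))
      - ENNReal.ofReal (risk P f ℓ θstar) ≤
    2 * ⨅ ρ : {ρ : Measure Θ // IsProbabilityMeasure ρ},
        ((∫⁻ θ, ENNReal.ofReal (risk P f ℓ θ) ∂ρ.1)
            - ENNReal.ofReal (risk P f ℓ θstar)
          + ENNReal.ofReal (max (2 * K) C) * KL ρ.1 π / n) := by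
  set M := max (2 * K) C
  have hM : 0 < M := lt_max_of_lt_right hC
  have hn' : (0 : ℝ) < n := Nat.cast_pos.2 hn
  rw [ENNReal.mul_iInf_of_ne (by simp) (by simp)]
  refine le_iInf fun ⟨ρ, hρ⟩ => ?_
  simp only
  by_cases hKL : ρ ≪ π ∧ Integrable (fun θ => Real.log ((ρ.rnDeriv π) θ).toReal) ρ
  swap
  · have : KL ρ π = ⊤ := if_neg hKL
    rw [this, ENNReal.mul_top (by simpa using hM), ENNReal.top_div_of_ne_top (by simp)]
    simp
  have hKLeq : KL ρ π = ENNReal.ofReal (∫ θ, llr ρ π θ ∂ρ) := if_pos hKL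
  obtain ⟨hac, hllr⟩ := hKL
  rw [hKLeq]
  set κ := ∫ θ, llr ρ π θ ∂ρ
  have hmθ : ∀ θ, Measurable fun p : X × Y => ℓ (f θ p.1) p.2 := fun θ =>
    hmeas.comp measurable_prodMk_left
  have hLint : ∀ θ, Integrable (fun p : X × Y => ℓ (f θ p.1) p.2) P := fun θ =>
    .of_mem_Icc 0 C (hmθ θ).aemeasurable (.of_forall fun p => hbound _ _)
  have hR : Measurable (risk P f ℓ) := hmeas.stronglyMeasurable.integral_prod_right.measurable
  have hR0 : ∀ θ, 0 ≤ risk P f ℓ θ := fun θ => integral_nonneg fun p => (hbound _ _).1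
  have hRC : ∀ θ, risk P f ℓ θ ≤ C := fun θ => by
    simpa [risk] using integral_mono (hLint θ) (integrable_const C) fun p => (hbound _ _).2
  have hRint : ∀ (μ : Measure Θ) [IsProbabilityMeasure μ], Integrable (risk P f ℓ) μ := fun μ _ =>
    .of_mem_Icc 0 C hR.aemeasurable (.of_forall fun θ => ⟨hR0 θ, hRC θ⟩)
  have hEmeas : Measurable fun q : (Fin n → X × Y) × Θ => empRisk f ℓ n q.1 q.2 := by
    have h1 : ∀ i : Fin n, Measurable fun q : (Fin n → X × Y) × Θ =>
        ℓ (f q.2 (q.1 i).1) (q.1 i).2 := fun i =>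
      hmeas.comp (measurable_snd.prodMk ((measurable_pi_apply i).comp measurable_fst))
    exact (Finset.measurable_fun_sum _ fun i _ => h1 i).div_const _
  have hE : ∀ ω θ, empRisk f ℓ n ω θ ∈ Set.Icc 0 C := fun ω θ => by
    refine ⟨div_nonneg (Finset.sum_nonneg fun i _ => (hbound _ _).1) hn'.le, ?_⟩
    rw [empRisk, div_le_iff₀ hn']
    have := Finset.sum_le_sum fun (i : Fin n) (_ : i ∈ Finset.univ) =>
      (hbound (f θ (ω i).1) (ω i).2).2
    simpa [mul_comm] using this
  have hEθ : ∀ ω, Measurable (empRisk f ℓ n ω) := fun ω => hEmeas.comp measurable_prodMk_left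
  have hEω : ∀ θ, Measurable fun ω => empRisk f ℓ n ω θ := fun θ =>
    hEmeas.comp measurable_prodMk_right
  have hEintP : ∀ θ, Integrable (fun ω => empRisk f ℓ n ω θ) (Measure.pi fun _ : Fin n => P) :=
    fun θ => .of_mem_Icc 0 C (hEω θ).aemeasurable (.of_forall fun ω => hE ω θ)
  have hEint : ∀ (ω) (μ : Measure Θ) [IsProbabilityMeasure μ], Integrable (empRisk f ℓ n ω) μ :=
    fun ω μ _ => .of_mem_Icc 0 C (hEθ ω).aemeasurable (.of_forall fun θ => hE ω θ)
  have hEmean : ∀ θ, ∫ ω, empRisk f ℓ n ω θ ∂(Measure.pi fun _ : Fin n => P) = risk P f ℓ θ :=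
    fun θ => by
    unfold empRisk
    rw [integral_div, integral_finsetSum]
    · have : ∀ i : Fin n, ∫ ω : Fin n → X × Y, ℓ (f θ (ω i).1) (ω i).2
          ∂(Measure.pi fun _ : Fin n => P) = risk P f ℓ θ := fun i =>
        integral_comp_eval (μ := fun _ : Fin n => P) (f := fun p : X × Y => ℓ (f θ p.1) p.2)
          (hmθ θ).aestronglyMeasurable
      simp [this, hn'.ne']
    · exact fun i _ => integrable_comp_eval (μ := fun _ : Fin n => P) (hLint θ)
  set lam : ℝ := n / M with hlam
  have hlam0 : 0 < lam := by positivity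
  set Rs := risk P f ℓ θstar
  -- The exponential moment bound.
  have hdmean : ∀ θ, ∫ p, (ℓ (f θ p.1) p.2 - ℓ (f θstar p.1) p.2) ∂P = risk P f ℓ θ - Rs :=
    fun θ => integral_sub (hLint θ) (hLint θstar)
  obtain ⟨hAint, hA1⟩ := integrable_and_integral_exp_bernstein_le_one P π
    (d := fun θ p => ℓ (f θ p.1) p.2 - ℓ (f θstar p.1) p.2)
    (hmeas.sub ((hmθ θstar).comp measurable_snd)) hM (le_max_left (2 * K) C)
    (fun θ p => by
      have h1 := hbound (f θ p.1) p.2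
      have h2 := hbound (f θstar p.1) p.2
      exact (abs_sub_le_of_nonneg_of_le h1.1 h1.2 h2.1 h2.2).trans (le_max_right _ _))
    (fun θ => by rw [hdmean]; exact sub_nonneg.2 (hstar θ))
    (fun θ => by rw [hdmean]; exact hBernstein θ) n
  have hexp : ∀ (ω : Fin n → X × Y) θ, n * (∫ p, (ℓ (f θ p.1) p.2 - ℓ (f θstar p.1) p.2) ∂P) /
        (2 * M) - (∑ i, (ℓ (f θ (ω i).1) (ω i).2 - ℓ (f θstar (ω i).1) (ω i).2)) / M =
      (lam / 2 * (risk P f ℓ θ - Rs) + lam * empRisk f ℓ n ω θstar) +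
        -lam * empRisk f ℓ n ω θ := fun ω θ => by
    rw [hdmean, Finset.sum_sub_distrib, hlam]
    unfold empRisk
    field_simp
    ring
  simp only [hexp] at hAint hA1
  set A : (Fin n → X × Y) → ℝ := fun ω =>
    ∫ θ, Real.exp ((lam / 2 * (risk P f ℓ θ - Rs) + lam * empRisk f ℓ n ω θstar) +
        -lam * empRisk f ℓ n ω θ) ∂π
  -- The integrated posterior risk at a fixed sample.
  have hgexp : ∀ ω, Integrable (fun θ => Real.exp (-lam * empRisk f ℓ n ω θ)) π := fun ω => by
    refine .of_mem_Icc 0 1 ((hEθ ω).const_mul _).exp.aemeasurable (.of_forall fun θ => ?_)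
    refine ⟨Real.exp_nonneg _, Real.exp_le_one_iff.2 ?_⟩
    have := mul_nonneg hlam0.le (hE ω θ).1
    linarith
  have hgprob : ∀ ω, IsProbabilityMeasure (gibbs π f ℓ lam n ω) := fun ω =>
    isProbabilityMeasure_tilted (hgexp ω)
  set B : (Fin n → X × Y) → ℝ := fun ω =>
    A ω - 1 - lam * empRisk f ℓ n ω θstar + lam * ∫ θ, empRisk f ℓ n ω θ ∂ρ + κ with hBdef
  have hpt : ∀ ω, lam / 2 * (∫ θ, risk P f ℓ θ ∂(gibbs π f ℓ lam n ω) - Rs) ≤ B ω := fun ω => by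
    have := hgprob ω
    have h1 := integral_sub_integral_llr_le_log_integral_exp ρ π hac hllr
      ((hEint ω ρ).const_mul (-lam)) (hgexp ω)
    have hi : Integrable (fun θ => lam / 2 * (risk P f ℓ θ - Rs)) (gibbs π f ℓ lam n ω) :=
      ((hRint _).sub (integrable_const _)).const_mul _
    have h2 := integral_tilted_le_integral_exp_sub π (hgexp ω)
      (h := fun θ => lam / 2 * (risk P f ℓ θ - Rs) + lam * empRisk f ℓ n ω θstar)
      (hi.add (integrable_const _)) (by
        refine .of_mem_Icc 0 (Real.exp (lam / 2 * (C - Rs) + lam * empRisk f ℓ n ω θstar + 0)) ?_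
          (.of_forall fun θ => ⟨Real.exp_nonneg _, Real.exp_le_exp.2 ?_⟩)
        · have := hEθ ω
          fun_prop
        · have := mul_nonneg hlam0.le (hE ω θ).1
          have := hRC θ
          gcongr
          linarith)
    change ∫ θ, _ ∂(gibbs π f ℓ lam n ω) ≤ A ω - 1 - _ at h2
    rw [integral_add hi (integrable_const _), integral_const_mul,
      integral_sub (hRint _) (integrable_const _)] at h2
    rw [integral_const_mul] at h1
    simp only [integral_const, probReal_univ, one_smul] at h2
    simp only [hBdef]
    linarith
  have hEuncurry : Integrable (Function.uncurry (empRisk f ℓ n))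
      ((Measure.pi fun _ : Fin n => P).prod ρ) :=
    .of_mem_Icc 0 C hEmeas.aemeasurable (.of_forall fun q => hE q.1 q.2)
  have hi1 := hAint.sub (integrable_const (1 : ℝ))
  have hi2 := hi1.sub ((hEintP θstar).const_mul lam)
  have hi3 := hi2.add (hEuncurry.integral_prod_left.const_mul lam)
  have hBint : Integrable B (Measure.pi fun _ : Fin n => P) := hi3.add (integrable_const κ)
  have hBmean : ∫ ω, B ω ∂(Measure.pi fun _ : Fin n => P) ≤
      lam * (∫ θ, risk P f ℓ θ ∂ρ - Rs) + κ := by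
    have e : ∫ ω, B ω ∂(Measure.pi fun _ : Fin n => P) =
        ∫ ω, A ω ∂(Measure.pi fun _ : Fin n => P) - 1 - lam * Rs +
          lam * ∫ θ, risk P f ℓ θ ∂ρ + κ := by
      have e1 := integral_add hi3 (integrable_const κ)
      have e2 := integral_add hi2 (hEuncurry.integral_prod_left.const_mul lam)
      have e3 := integral_sub hi1 ((hEintP θstar).const_mul lam)
      have e4 := integral_sub hAint (integrable_const (1 : ℝ))
      have e5 := integral_integral_swap hEuncurry
      simp only [hEmean] at e5
      simp only [integral_const_mul, integral_const, probReal_univ, one_smul, hEmean,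
        Pi.add_apply, Pi.sub_apply, Function.uncurry_apply_pair] at e1 e2 e3 e4
      rw [e4] at e3
      rw [e3, e5] at e2
      rw [e2] at e1
      exact e1
    rw [e]
    linarith
  have hBnn : ∀ ω, 0 ≤ Rs + 2 / lam * B ω := fun ω => by
    have := hgprob ω
    have h1 : Rs ≤ ∫ θ, risk P f ℓ θ ∂(gibbs π f ℓ lam n ω) := by
      simpa using integral_mono (integrable_const Rs) (hRint (gibbs π f ℓ lam n ω)) hstar
    have h2 : 0 ≤ B ω := (mul_nonneg (by positivity) (sub_nonneg.2 h1)).trans (hpt ω)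
    have : 0 ≤ Rs := hR0 θstar
    positivity
  have hLHS : ∫⁻ ω, ∫⁻ θ, ENNReal.ofReal (risk P f ℓ θ) ∂(gibbs π f ℓ lam n ω)
      ∂(Measure.pi fun _ : Fin n => P) ≤
      ENNReal.ofReal (∫ ω, (Rs + 2 / lam * B ω) ∂(Measure.pi fun _ : Fin n => P)) := by
    have hi : Integrable (fun ω => Rs + 2 / lam * B ω) (Measure.pi fun _ : Fin n => P) :=
      (integrable_const _).add (hBint.const_mul _)
    rw [ofReal_integral_eq_lintegral_ofReal hi (.of_forall hBnn)]
    refine lintegral_mono fun ω => ?_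
    have := hgprob ω
    rw [← ofReal_integral_eq_lintegral_ofReal (hRint _) (.of_forall hR0)]
    refine ENNReal.ofReal_le_ofReal ?_
    have h := mul_le_mul_of_nonneg_left (hpt ω) (by positivity : 0 ≤ 2 / lam)
    have e : ∀ x : ℝ, 2 / lam * (lam / 2 * x) = x := fun x => by field_simp
    rw [e] at h
    linarith
  rw [integral_add (integrable_const _) (hBint.const_mul _), integral_const_mul] at hLHS
  simp only [integral_const, probReal_univ, one_smul] at hLHS
  refine (tsub_le_tsub_right hLHS _).trans ?_
  rw [← ENNReal.ofReal_sub _ (hR0 θstar), ← ofReal_integral_eq_lintegral_ofReal (hRint ρ)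
    (.of_forall hR0), ← ENNReal.ofReal_sub _ (hR0 θstar), ← ENNReal.ofReal_mul hM.le,
    ← ENNReal.ofReal_natCast n, ← ENNReal.ofReal_div_of_pos hn']
  calc _ ≤ ENNReal.ofReal (2 * ((∫ θ, risk P f ℓ θ ∂ρ - Rs) + M * κ / n)) := by
        refine ENNReal.ofReal_le_ofReal ?_
        have h := mul_le_mul_of_nonneg_left hBmean (by positivity : 0 ≤ 2 / lam)
        have e : 2 / lam * (lam * (∫ θ, risk P f ℓ θ ∂ρ - Rs) + κ) =
            2 * ((∫ θ, risk P f ℓ θ ∂ρ - Rs) + M * κ / n) := by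
          rw [hlam]
          field_simp
        rw [e] at h
        linarith
    _ ≤ _ := by
        rw [ENNReal.ofReal_mul zero_le_two, ENNReal.ofReal_ofNat]
        gcongr
        exact ENNReal.ofReal_add_le
end
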